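/- arXiv:2002.01930 — 6 statements merged into one kernel-verified Lean document; each statement's English description precedes it below -/
import Mathlib

section
/- Let K be a field and let P ∈ K[X] be a polynomial of degree ν ≥ 1 with leading coefficient c_ν that has ν distinct roots α₁, …, α_ν in K. Let P_f, Q_f ∈ K[X] with gcd(P, Q_f) = 1 and gcd(P_f, Q_f) = 1, and let P̃, Q̃_f ∈ K[X] satisfy the Bezout relation P̃·P + Q̃_f·Q_f = 1 (so Q̃_f is the polynomial inverse of Q_f with respect to the ideal ⟨P⟩). Then Σ_{i=1}^{ν} P_f(αᵢ) / (Q_f(αᵢ)·P'(αᵢ)) = a_ν / c_ν, where a_ν is the coefficient of X^{ν−1} in the remainder of P_f·Q̃_f upon division by P. -/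
open Polynomial

/-- A polynomial of degree `#s` vanishing at the `#s` distinct nodes `v i` is its leading
coefficient times the nodal polynomial. -/
theorem eq_C_leadingCoeff_mul_nodal {K ι : Type*} [Field K] {s : Finset ι} {v : ι → K}
    {P : K[X]} (hv : Set.InjOn v s) (hdeg : P.natDegree = s.card) (hP : P ≠ 0)
    (hroot : ∀ i ∈ s, P.eval (v i) = 0) :
    P = C P.leadingCoeff * Lagrange.nodal s v := by
  have hlc : P.leadingCoeff ≠ 0 := leadingCoeff_ne_zero.mpr hP
  have hd : P.degree = s.card := by rw [degree_eq_natDegree hP, hdeg]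
  refine eq_of_degree_le_of_eval_index_eq s hv hd.le ?_ ?_ fun i hi => ?_
  · rw [degree_C_mul hlc, Lagrange.degree_nodal, hd]
  · rw [leadingCoeff_mul, leadingCoeff_C, Lagrange.nodal_monic.leadingCoeff, mul_one]
  · rw [hroot i hi, eval_C_mul, Lagrange.eval_nodal_at_node hi, mul_zero]

/-- The residue sum of a polynomial `R` of degree less than `#s` against a polynomial `P` of degree
`#s` with simple roots `v i`. -/
theorem sum_eval_div_eval_derivative {K ι : Type*} [Field K] {s : Finset ι} {v : ι → K}
    {P R : K[X]} (hv : Set.InjOn v s) (hdeg : P.natDegree = s.card) (hP : P ≠ 0)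
    (hroot : ∀ i ∈ s, P.eval (v i) = 0) (hR : R.degree < s.card) :
    ∑ i ∈ s, R.eval (v i) / (derivative P).eval (v i)
      = R.coeff (s.card - 1) / P.leadingCoeff := by
  classical
  rw [Lagrange.coeff_eq_sum hv hR, Finset.sum_div]
  refine Finset.sum_congr rfl fun i hi => ?_
  have hder : (derivative P).eval (v i)
      = P.leadingCoeff * ∏ j ∈ s.erase i, (v i - v j) := by
    conv_lhs => rw [eq_C_leadingCoeff_mul_nodal hv hdeg hP hroot]
    rw [derivative_C_mul, eval_C_mul, Lagrange.eval_nodal_derivative_eval_node_eq hi,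
      Lagrange.eval_nodal]
  rw [hder, div_div, mul_comm]

/-- The global residue of the rational function `P_f/Q_f` with respect to the ideal `⟨P⟩`,
i.e. `∑ᵢ P_f(αᵢ)/(Q_f(αᵢ)·P'(αᵢ))` where the `αᵢ` are the (simple) roots of `P`,
equals `a_ν / c_ν`, where `a_ν` is the coefficient of `X^(ν-1)` in the remainder of
`P_f·Q̃_f` upon division by `P` and `c_ν` is the leading coefficient of `P`.
Here `Q̃_f` is the polynomial inverse of `Q_f` modulo `P`, coming from a Bezout
relation `P̃·P + Q̃_f·Q_f = 1`. -/
theorem global_residue_eq_coeff_div_leadingCoeff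
    {K : Type*} [Field K] (ν : ℕ) (hν : 1 ≤ ν)
    (P Pf Qf Pt Qt : Polynomial K)
    (hdeg : P.natDegree = ν)
    (α : Fin ν → K) (hα : Function.Injective α)
    (hroot : ∀ i, P.eval (α i) = 0)
    (hPQf : IsCoprime P Qf) (hPfQf : IsCoprime Pf Qf)
    (hbez : Pt * P + Qt * Qf = 1) :
    ∑ i, Pf.eval (α i) / (Qf.eval (α i) * (Polynomial.derivative P).eval (α i))
      = ((Pf * Qt) % P).coeff (ν - 1) / P.leadingCoeff := by
  have hP : P ≠ 0 := by
    rintro rfl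
    simp at hdeg
    omega
  have hmod : ((Pf * Qt) % P).degree < (Finset.univ : Finset (Fin ν)).card := by
    rw [Finset.card_univ, Fintype.card_fin, ← hdeg, ← degree_eq_natDegree hP]
    exact degree_mod_lt _ hP
  have key := sum_eval_div_eval_derivative hα.injOn (by simpa using hdeg) hP
    (fun i _ => hroot i) hmod
  rw [Finset.card_univ, Fintype.card_fin] at key
  rw [← key]
  refine Finset.sum_congr rfl fun i _ => ?_
  have hinv : Qt.eval (α i) * Qf.eval (α i) = 1 := by
    simpa [hroot i] using congrArg (eval (α i)) hbez
  have heval : ((Pf * Qt) % P).eval (α i) = Pf.eval (α i) * Qt.eval (α i) := by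
    simpa [hroot i] using congrArg (eval (α i)) (EuclideanDomain.mod_add_div (Pf * Qt) P)
  rw [heval, eq_inv_of_mul_eq_one_left hinv, ← div_eq_mul_inv, div_div]
end

section
/- Let K be a field and let P ∈ K[X] be a polynomial of degree ν ≥ 1 with leading coefficient c_ν that has ν distinct roots α₁, …, α_ν in K. Then for every polynomial g ∈ K[X], Σ_{i=1}^{ν} g(αᵢ)/P'(αᵢ) = a_ν / c_ν, where a_ν is the coefficient of X^{ν−1} in the remainder of g upon division by P. (In particular, for deg g ≤ ν − 2 the sum vanishes.) -/
open Polynomial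

/-- For a polynomial `P` of degree `ν ≥ 1` with `ν` distinct roots `α₁, …, α_ν` in `K`,
and any polynomial `g`, the global residue `∑ᵢ g(αᵢ)/P'(αᵢ)` equals `a_ν / c_ν`,
where `a_ν` is the coefficient of `X^(ν-1)` in the remainder of `g` upon division by `P`
and `c_ν` is the leading coefficient of `P`. -/
theorem global_residue_polynomial_eq_coeff_div_leadingCoeff
    {K : Type*} [Field K] (ν : ℕ) (hν : 1 ≤ ν)
    (P : Polynomial K) (hdeg : P.natDegree = ν)
    (α : Fin ν → K) (hα : Function.Injective α)
    (hroot : ∀ i, P.eval (α i) = 0)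
    (g : Polynomial K) :
    ∑ i, g.eval (α i) / (Polynomial.derivative P).eval (α i)
      = (g % P).coeff (ν - 1) / P.leadingCoeff := by
  have hP0 : P ≠ 0 := by
    rintro rfl
    simp at hdeg
    omega
  have hP : P = C P.leadingCoeff * Lagrange.nodal Finset.univ α := by
    refine Polynomial.eq_of_degree_le_of_eval_index_eq Finset.univ hα.injOn ?_ ?_ ?_ ?_
    · rw [Polynomial.degree_eq_natDegree hP0, hdeg]
      simp
    · rw [Polynomial.degree_C_mul (leadingCoeff_ne_zero.mpr hP0), Lagrange.degree_nodal,
        Polynomial.degree_eq_natDegree hP0, hdeg]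
      simp
    · simp [Lagrange.nodal_monic.leadingCoeff]
    · intro i _
      simp [hroot, Lagrange.eval_nodal_at_node]
  have hderiv (i : Fin ν) : (derivative P).eval (α i)
      = P.leadingCoeff * ∏ j ∈ Finset.univ.erase i, (α i - α j) := by
    conv_lhs => rw [hP]
    rw [derivative_C_mul, eval_C_mul,
      Lagrange.eval_nodal_derivative_eval_node_eq (Finset.mem_univ i), Lagrange.eval_nodal]
  have hmod (i : Fin ν) : (g % P).eval (α i) = g.eval (α i) := by
    conv_rhs => rw [← EuclideanDomain.mod_add_div g P]
    simp [hroot]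
  have hcard : (Finset.univ : Finset (Fin ν)).card = ν := by simp
  have hlt : (g % P).degree < (Finset.univ : Finset (Fin ν)).card := by
    rw [hcard, ← hdeg, ← Polynomial.degree_eq_natDegree hP0]
    exact EuclideanDomain.mod_lt g hP0
  have hcoeff := Lagrange.coeff_eq_sum hα.injOn hlt
  rw [hcard] at hcoeff
  rw [hcoeff, Finset.sum_div]
  refine Finset.sum_congr rfl fun i _ => ?_
  rw [hderiv, hmod, div_div, mul_comm P.leadingCoeff]
end

section
/- Let K be a field and let P = Σ_{j=0}^{ν} c_j X^j ∈ K[X] be a polynomial of degree ν ≥ 1 with ν distinct roots α₁, …, α_ν in K. For 1 ≤ j ≤ ν define w_j = Σ_{k=0}^{ν−j} c_{k+j} X^k. Then the basis {w_j} is dual to the monomial basis {v_i = X^{i−1}} of K[X]/⟨P⟩ with respect to the global-residue pairing: for all 1 ≤ i, j ≤ ν, Σ_{m=1}^{ν} α_m^{i−1} · w_j(α_m) / P'(α_m) = δ_{ij} (Kronecker delta). -/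
open Polynomial

namespace Polynomial

variable {K : Type*} [Field K]

theorem eval_divByMonic_X_sub_C_self {P : K[X]} {a : K} (h : P.eval a = 0) :
    (P /ₘ (X - C a)).eval a = (derivative P).eval a := by
  have hP : (X - C a) * (P /ₘ (X - C a)) = P := mul_divByMonic_eq_iff_isRoot.2 h
  conv_rhs => rw [← hP]
  simp

theorem eval_divByMonic_X_sub_C_of_ne {P : K[X]} {a b : K} (ha : P.eval a = 0)
    (hb : P.eval b = 0) (hab : b ≠ a) : (P /ₘ (X - C a)).eval b = 0 := by
  have hP : (X - C a) * (P /ₘ (X - C a)) = P := mul_divByMonic_eq_iff_isRoot.2 ha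
  rw [← hP, eval_mul] at hb
  refine (mul_eq_zero.1 hb).resolve_left ?_
  simpa [sub_eq_zero] using hab

/-- A nonzero polynomial with as many distinct roots as its degree has only simple roots. -/
theorem eval_derivative_ne_zero_of_injective_roots {ν : ℕ} {P : K[X]} (hP0 : P ≠ 0)
    (hdeg : P.natDegree = ν) {α : Fin ν → K} (hα : Function.Injective α)
    (hroot : ∀ m, P.eval (α m) = 0) (m : Fin ν) : (derivative P).eval (α m) ≠ 0 := by
  intro h
  have hP : (X - C (α m)) * (P /ₘ (X - C (α m))) = P :=
    mul_divByMonic_eq_iff_isRoot.2 (hroot m)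
  have hQ : P /ₘ (X - C (α m)) = 0 := by
    refine eq_zero_of_natDegree_lt_card_of_eval_eq_zero _ hα (fun k => ?_) ?_
    · by_cases hk : k = m
      · rw [hk, eval_divByMonic_X_sub_C_self (hroot m), h]
      · exact eval_divByMonic_X_sub_C_of_ne (hroot m) (hroot k) (hα.ne hk)
    · rw [natDegree_divByMonic _ (monic_X_sub_C _), natDegree_X_sub_C, hdeg, Fintype.card_fin]
      have := m.pos
      omega
  rw [hQ, mul_zero] at hP
  exact hP0 hP.symm

/-- Lagrange interpolation at the roots of `P`. -/
theorem sum_divByMonic_X_sub_C_eq {ν : ℕ} {P : K[X]} (hP0 : P ≠ 0)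
    (hdeg : P.natDegree = ν) {α : Fin ν → K} (hα : Function.Injective α)
    (hroot : ∀ m, P.eval (α m) = 0) {f : K[X]} (hf : f.degree < ν) :
    ∑ m, C (f.eval (α m) / (derivative P).eval (α m)) * (P /ₘ (X - C (α m))) = f := by
  refine eq_of_degrees_lt_of_eval_index_eq (v := α) Finset.univ hα.injOn ?_
    (by simpa using hf) fun k _ => ?_
  · rw [← mem_degreeLT]
    refine Submodule.sum_mem _ fun m _ => ?_
    rw [← smul_eq_C_mul]
    refine Submodule.smul_mem _ _ (mem_degreeLT.2 ?_)
    refine (degree_divByMonic_lt P (X - C (α m)) hP0 (by simp)).trans_le ?_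
    rw [degree_eq_natDegree hP0, hdeg, Finset.card_univ, Fintype.card_fin]
  · rw [eval_finsetSum, Finset.sum_eq_single k]
    · rw [eval_mul, eval_C, eval_divByMonic_X_sub_C_self (hroot k),
        div_mul_cancel₀ _ (eval_derivative_ne_zero_of_injective_roots hP0 hdeg hα hroot k)]
    · intro m _ hm
      rw [eval_mul, eval_divByMonic_X_sub_C_of_ne (hroot m) (hroot k) (hα.ne hm.symm), mul_zero]
    · simp

end Polynomial

/-- Duality of the Bezoutian basis: for `P = ∑_{j=0}^{ν} c_j X^j` of degree `ν ≥ 1` with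
`ν` distinct roots `α₁, …, α_ν` in `K`, the polynomials `w_j = ∑_{k=0}^{ν-j} c_{k+j} X^k`
are dual to the monomials `v_i = X^(i-1)` with respect to the global-residue pairing:
`∑_m α_m^(i-1) · w_j(α_m) / P'(α_m) = δ_{ij}` for `1 ≤ i, j ≤ ν`. -/
theorem bezoutian_dual_basis
    {K : Type*} [Field K] (ν : ℕ) (hν : 1 ≤ ν)
    (c : ℕ → K) (P : Polynomial K)
    (hP : P = ∑ j ∈ Finset.range (ν + 1), Polynomial.C (c j) * Polynomial.X ^ j)
    (hdeg : P.natDegree = ν)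
    (α : Fin ν → K) (hα : Function.Injective α)
    (hroot : ∀ m, P.eval (α m) = 0)
    (i j : ℕ) (hi1 : 1 ≤ i) (hiν : i ≤ ν) (hj1 : 1 ≤ j) (hjν : j ≤ ν) :
    ∑ m, α m ^ (i - 1)
        * (∑ k ∈ Finset.range (ν - j + 1), Polynomial.C (c (k + j)) * Polynomial.X ^ k).eval (α m)
        / (Polynomial.derivative P).eval (α m)
      = if i = j then 1 else 0 := by
  have hP0 : P ≠ 0 := by
    rintro rfl
    rw [natDegree_zero] at hdeg
    omega
  have hcoeff : ∀ n ≤ ν, P.coeff n = c n := fun n hn => by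
    rw [hP]
    simp [coeff_X_pow, hn]
  have hdeg_pow : (X ^ (i - 1) : K[X]).degree < ν := by
    rw [degree_X_pow]
    exact_mod_cast (by omega : i - 1 < ν)
  have key := congrArg (fun f => coeff f (j - 1))
    (sum_divByMonic_X_sub_C_eq hP0 hdeg hα hroot hdeg_pow)
  simp only [finsetSum_coeff, coeff_C_mul, coeff_X_pow, eval_pow, eval_X] at key
  have hij : (j - 1 = i - 1) ↔ i = j := by omega
  simp only [hij] at key
  rw [← key]
  refine Finset.sum_congr rfl fun m _ => ?_
  rw [mul_div_right_comm, coeff_divByMonic_X_sub_C, hdeg, Nat.sub_add_cancel hj1,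
    eval_finsetSum, ← Finset.Ico_add_one_right_eq_Icc, Finset.sum_Ico_eq_sum_range,
    Nat.sub_add_comm hjν]
  congr 1
  refine Finset.sum_congr rfl fun k hk => ?_
  rw [Finset.mem_range] at hk
  rw [hcoeff _ (by omega), Nat.add_sub_cancel_left, add_comm j k]
  simp only [eval_mul, eval_C, eval_pow, eval_X, mul_comm]
end

section
/- Let K be a field, ν ≥ 1, o ≥ 2, and let Ω be a ν×ν matrix with entries in the field of rational functions RatFunc K such that every nonzero entry Ω_{kj}, written in lowest terms, has numerator of degree strictly less than its denominator (intDegree ≤ −1). Let c₁, …, c_ν ∈ K and set f_j = c_j·X^{o−1}, and let φ₁, …, φ_ν ∈ RatFunc K be such that each nonzero φ_j has intDegree ≤ o − 2. Then for each j, the gauge-transformed function φ'_j = φ_j + f_j' + Σ_{k=1}^{ν} f_k·Ω_{kj} (where f_j' is the derivative of f_j) is either zero or has intDegree ≤ o − 2; i.e., the gauge transformation with polynomial seed of degree o−1 does not increase the pole order at infinity beyond o. -/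
open Polynomial

namespace RatFunc

variable {K : Type*} [Field K]

theorem eq_zero_or_intDegree_add_le {x y : RatFunc K} {n : ℤ}
    (hx : x = 0 ∨ x.intDegree ≤ n) (hy : y = 0 ∨ y.intDegree ≤ n) :
    x + y = 0 ∨ (x + y).intDegree ≤ n := by
  rcases hx with rfl | hx
  · simpa using hy
  rcases hy with rfl | hy
  · simpa using Or.inr hx
  by_cases hy₀ : y = 0
  · subst hy₀
    simpa using Or.inr hx
  exact or_iff_not_imp_left.2 fun hxy =>
    (intDegree_add_le hy₀ hxy).trans (max_le hx hy)

theorem eq_zero_or_intDegree_sum_le {ι : Type*} (s : Finset ι) (f : ι → RatFunc K) {n : ℤ}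
    (hf : ∀ i ∈ s, f i = 0 ∨ (f i).intDegree ≤ n) :
    ∑ i ∈ s, f i = 0 ∨ (∑ i ∈ s, f i).intDegree ≤ n :=
  Finset.sum_induction f (fun x => x = 0 ∨ x.intDegree ≤ n)
    (fun _ _ => eq_zero_or_intDegree_add_le) (Or.inl rfl) hf

theorem eq_zero_or_intDegree_mul_le {x y : RatFunc K} {m n : ℤ}
    (hx : x = 0 ∨ x.intDegree ≤ m) (hy : y = 0 ∨ y.intDegree ≤ n) :
    x * y = 0 ∨ (x * y).intDegree ≤ m + n := by
  refine or_iff_not_imp_left.2 fun hxy => ?_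
  have hx₀ := left_ne_zero_of_mul hxy
  have hy₀ := right_ne_zero_of_mul hxy
  rw [intDegree_mul hx₀ hy₀]
  exact add_le_add (hx.resolve_left hx₀) (hy.resolve_left hy₀)

end RatFunc

/-- Gauge transformation with a polynomial seed `f_j = c_j·X^(o-1)` does not increase the
pole order at infinity beyond `o`: if every nonzero entry of `Ω` has `intDegree ≤ -1`
(simple pole structure at infinity) and every nonzero `φ_j` has `intDegree ≤ o - 2`,
then each gauge-transformed `φ'_j = φ_j + f_j' + ∑_k f_k·Ω_{kj}` is zero or has
`intDegree ≤ o - 2`. -/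
theorem gauge_transformation_pole_at_infinity
    {K : Type*} [Field K] (ν o : ℕ) (hν : 1 ≤ ν) (ho : 2 ≤ o)
    (Ω : Matrix (Fin ν) (Fin ν) (RatFunc K))
    (hΩ : ∀ k j, Ω k j ≠ 0 → (Ω k j).intDegree ≤ -1)
    (c : Fin ν → K)
    (φ : Fin ν → RatFunc K)
    (hφ : ∀ j, φ j ≠ 0 → (φ j).intDegree ≤ (o : ℤ) - 2) :
    ∀ j,
      (φ j
        + algebraMap (Polynomial K) (RatFunc K)
            (Polynomial.derivative (Polynomial.C (c j) * Polynomial.X ^ (o - 1)))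
        + ∑ k, algebraMap (Polynomial K) (RatFunc K)
            (Polynomial.C (c k) * Polynomial.X ^ (o - 1)) * Ω k j) = 0
      ∨
      (φ j
        + algebraMap (Polynomial K) (RatFunc K)
            (Polynomial.derivative (Polynomial.C (c j) * Polynomial.X ^ (o - 1)))
        + ∑ k, algebraMap (Polynomial K) (RatFunc K)
            (Polynomial.C (c k) * Polynomial.X ^ (o - 1)) * Ω k j).intDegree ≤ (o : ℤ) - 2 := by
  intro j
  have hdeg (k : Fin ν) : (C (c k) * X ^ (o - 1)).natDegree ≤ o - 1 :=
    natDegree_C_mul_X_pow_le _ _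
  refine RatFunc.eq_zero_or_intDegree_add_le (RatFunc.eq_zero_or_intDegree_add_le
    (or_iff_not_imp_left.2 (hφ j)) (Or.inr ?_))
    (RatFunc.eq_zero_or_intDegree_sum_le _ _ fun k _ => ?_)
  · rw [RatFunc.intDegree_polynomial]
    have := natDegree_derivative_le (C (c j) * X ^ (o - 1))
    have := hdeg j
    omega
  · have hseed : (algebraMap K[X] (RatFunc K) (C (c k) * X ^ (o - 1))).intDegree
        ≤ (o : ℤ) - 1 := by
      rw [RatFunc.intDegree_polynomial]
      have := hdeg k
      omega
    have := RatFunc.eq_zero_or_intDegree_mul_le (Or.inr hseed)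
      (or_iff_not_imp_left.2 (hΩ k j))
    rwa [show (o : ℤ) - 1 + -1 = o - 2 by ring] at this
end

section
/- Let K be a field, ν ≥ 1, o ≥ 2, and let q ∈ K[X] be an irreducible polynomial. Let Ω be a ν×ν matrix with entries in RatFunc K such that every entry has squarefree denominator. Let f_j = g_j/q^{o−1} with g_j ∈ K[X] of degree < deg q, and let φ₁, …, φ_ν ∈ RatFunc K be such that each φ_j can be written with denominator dividing q^o·s_j for some squarefree polynomial s_j coprime to q. Then for each j, the gauge-transformed function φ'_j = φ_j + f_j' + Σ_{k=1}^{ν} f_k·Ω_{kj} can be written with denominator dividing q^o·t_j for some squarefree polynomial t_j coprime to q; i.e., the gauge transformation with seed g_j/q^{o−1} produces a pole of order at most o along q and does not introduce higher poles at any other finite point. -/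
open Polynomial

/-- Two squarefree polynomials coprime to `q` have a squarefree common multiple coprime to `q`. -/
theorem exists_squarefree_common_multiple {K : Type*} [Field K] {q s₁ s₂ : K[X]}
    (h₁ : Squarefree s₁) (h₂ : Squarefree s₂) (c₁ : IsCoprime s₁ q) (c₂ : IsCoprime s₂ q) :
    ∃ t : K[X], Squarefree t ∧ IsCoprime t q ∧ s₁ ∣ t ∧ s₂ ∣ t := by
  classical
  have h0 : s₁ * s₂ ≠ 0 := mul_ne_zero h₁.ne_zero h₂.ne_zero
  refine ⟨UniqueFactorizationMonoid.radical (s₁ * s₂),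
    UniqueFactorizationMonoid.squarefree_radical,
    (c₁.mul_left c₂).of_isCoprime_of_dvd_left UniqueFactorizationMonoid.radical_dvd_self, ?_, ?_⟩
  · exact (UniqueFactorizationMonoid.dvd_radical_iff h₁.isRadical h0).2 (dvd_mul_right _ _)
  · exact (UniqueFactorizationMonoid.dvd_radical_iff h₂.isRadical h0).2 (dvd_mul_left _ _)

namespace RatFunc

/-- A sum of two rational functions has denominator dividing any common denominator. -/
theorem denom_add_dvd_of_dvd {K : Type*} [Field K] {x y : RatFunc K} {d : K[X]}
    (hx : x.denom ∣ d) (hy : y.denom ∣ d) : (x + y).denom ∣ d := by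
  by_cases hd : d = 0
  · simp [hd]
  rw [denom_dvd hd] at *
  obtain ⟨a, rfl⟩ := hx
  obtain ⟨b, rfl⟩ := hy
  exact ⟨a + b, by rw [map_add, add_div]⟩

/-- `x` has a pole of order at most `o` along `q`, and only simple finite poles elsewhere. -/
def PoleBound {K : Type*} [Field K] (q : K[X]) (o : ℕ) (x : RatFunc K) : Prop :=
  ∃ t : K[X], Squarefree t ∧ IsCoprime t q ∧ x.denom ∣ q ^ o * t

theorem PoleBound.add {K : Type*} [Field K] {q : K[X]} {o : ℕ} {x y : RatFunc K}
    (hx : PoleBound q o x) (hy : PoleBound q o y) : PoleBound q o (x + y) := by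
  obtain ⟨s₁, h₁, c₁, d₁⟩ := hx
  obtain ⟨s₂, h₂, c₂, d₂⟩ := hy
  obtain ⟨t, ht, ct, e₁, e₂⟩ := exists_squarefree_common_multiple h₁ h₂ c₁ c₂
  exact ⟨t, ht, ct, denom_add_dvd_of_dvd (d₁.trans (mul_dvd_mul_left _ e₁))
    (d₂.trans (mul_dvd_mul_left _ e₂))⟩

theorem poleBound_of_denom_dvd {K : Type*} [Field K] {q : K[X]} {o : ℕ} {x : RatFunc K}
    (hx : x.denom ∣ q ^ o) : PoleBound q o x :=
  ⟨1, squarefree_one, isCoprime_one_left, by simpa using hx⟩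

theorem PoleBound.sum {K ι : Type*} [Field K] {q : K[X]} {o : ℕ} (s : Finset ι)
    {x : ι → RatFunc K} (hx : ∀ i ∈ s, PoleBound q o (x i)) : PoleBound q o (∑ i ∈ s, x i) :=
  Finset.sum_induction _ (PoleBound q o) (fun _ _ => PoleBound.add)
    (poleBound_of_denom_dvd (by simp)) hx

/-- A function with squarefree denominator has at most a simple pole along an irreducible `q`. -/
theorem poleBound_one_of_squarefree_denom {K : Type*} [Field K] {q : K[X]} (hq : Irreducible q)
    {x : RatFunc K} (hx : Squarefree x.denom) : PoleBound q 1 x := by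
  by_cases h : q ∣ x.denom
  · obtain ⟨e, he⟩ := h
    rw [he] at hx
    refine ⟨e, hx.of_mul_right, ?_, by rw [he, pow_one]⟩
    refine ((hq.coprime_iff_not_dvd).2 fun hqe => hq.not_isUnit (hx q ?_)).symm
    exact mul_dvd_mul_left q hqe
  · exact ⟨x.denom, hx, ((hq.coprime_iff_not_dvd).2 h).symm, dvd_mul_left _ _⟩

theorem PoleBound.mul_of_denom_dvd {K : Type*} [Field K] {q : K[X]} {m n : ℕ} {x y : RatFunc K}
    (hx : x.denom ∣ q ^ m) (hy : PoleBound q n y) : PoleBound q (m + n) (x * y) := by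
  obtain ⟨t, ht, ct, d⟩ := hy
  refine ⟨t, ht, ct, (denom_mul_dvd x y).trans ?_⟩
  rw [pow_add, mul_assoc]
  exact mul_dvd_mul hx d

/-- A derivation raises the order of a pole along `q` by at most one. -/
theorem denom_derivation_div_pow_dvd {K : Type*} [Field K] {D : RatFunc K → RatFunc K}
    (hD_mul : ∀ a b : RatFunc K, D (a * b) = a * D b + D a * b)
    (hD_poly : ∀ p : K[X], D (algebraMap K[X] (RatFunc K) p)
      = algebraMap K[X] (RatFunc K) (derivative p))
    {q : K[X]} (hq : q ≠ 0) (g : K[X]) (n : ℕ) :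
    (D (algebraMap K[X] (RatFunc K) g / algebraMap K[X] (RatFunc K) (q ^ (n + 1)))).denom
      ∣ q ^ (n + 2) := by
  have hB : algebraMap K[X] (RatFunc K) (q ^ (n + 1)) ≠ 0 := algebraMap_ne_zero (pow_ne_zero _ hq)
  rw [denom_dvd (pow_ne_zero _ hq)]
  refine ⟨derivative g * q - g * ((n + 1 : ℕ) : K[X]) * derivative q, ?_⟩
  set f := algebraMap K[X] (RatFunc K) g / algebraMap K[X] (RatFunc K) (q ^ (n + 1)) with hf
  have key := hD_mul f (algebraMap K[X] (RatFunc K) (q ^ (n + 1)))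
  rw [hf, div_mul_cancel₀ _ hB, ← hf, hD_poly, hD_poly, derivative_pow_succ] at key
  rw [eq_div_iff (algebraMap_ne_zero (pow_ne_zero _ hq))]
  have hg : f * algebraMap K[X] (RatFunc K) (q ^ (n + 1)) = algebraMap K[X] (RatFunc K) g :=
    div_mul_cancel₀ _ hB
  simp only [map_mul, map_sub, map_pow, map_add, map_natCast, map_one, Nat.cast_add, Nat.cast_one]
    at key hg ⊢
  rw [key, ← hg]
  ring

end RatFunc

/-- Pole control in the reduction of a pole of order `o ≥ 2` along an irreducible
polynomial `q`: if every entry of `Ω` has squarefree denominator, the seeds are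
`f_j = g_j/q^(o-1)` with `deg g_j < deg q`, and each `φ_j` has denominator dividing
`q^o·s_j` for some squarefree `s_j` coprime to `q`, then each gauge-transformed
`φ'_j = φ_j + D(f_j) + ∑_k f_k·Ω_{kj}` has denominator dividing `q^o·t_j` for some
squarefree `t_j` coprime to `q`.  Here `D` is the unique derivation on `RatFunc K`
extending the formal derivative of polynomials. -/
theorem gauge_transformation_finite_pole_control
    {K : Type*} [Field K] (ν o : ℕ) (hν : 1 ≤ ν) (ho : 2 ≤ o)
    (q : Polynomial K) (hq : Irreducible q)
    (Ω : Matrix (Fin ν) (Fin ν) (RatFunc K))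
    (hΩ : ∀ k j, Squarefree (Ω k j).denom)
    (g : Fin ν → Polynomial K) (hg : ∀ j, (g j).degree < q.degree)
    (D : RatFunc K → RatFunc K)
    (hD_add : ∀ a b : RatFunc K, D (a + b) = D a + D b)
    (hD_mul : ∀ a b : RatFunc K, D (a * b) = a * D b + D a * b)
    (hD_poly : ∀ p : Polynomial K,
      D (algebraMap (Polynomial K) (RatFunc K) p)
        = algebraMap (Polynomial K) (RatFunc K) (Polynomial.derivative p))
    (φ : Fin ν → RatFunc K)
    (hφ : ∀ j, ∃ s : Polynomial K, Squarefree s ∧ IsCoprime s q ∧ (φ j).denom ∣ q ^ o * s) :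
    ∀ j, ∃ t : Polynomial K, Squarefree t ∧ IsCoprime t q ∧
      (φ j
        + D (algebraMap (Polynomial K) (RatFunc K) (g j)
              / algebraMap (Polynomial K) (RatFunc K) (q ^ (o - 1)))
        + ∑ k, (algebraMap (Polynomial K) (RatFunc K) (g k)
              / algebraMap (Polynomial K) (RatFunc K) (q ^ (o - 1))) * Ω k j).denom
        ∣ q ^ o * t := by
  intro j
  obtain ⟨n, rfl⟩ : ∃ n, o = n + 2 := ⟨o - 2, by omega⟩
  rw [show n + 2 - 1 = n + 1 from rfl]
  have hderiv := RatFunc.poleBound_of_denom_dvd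
    (RatFunc.denom_derivation_div_pow_dvd hD_mul hD_poly hq.ne_zero (g j) n)
  have hsum : RatFunc.PoleBound q (n + 2) (∑ k, (algebraMap K[X] (RatFunc K) (g k)
      / algebraMap K[X] (RatFunc K) (q ^ (n + 1))) * Ω k j) :=
    RatFunc.PoleBound.sum _ fun k _ =>
      RatFunc.PoleBound.mul_of_denom_dvd (m := n + 1) (n := 1) (RatFunc.denom_div_dvd _ _)
        (RatFunc.poleBound_one_of_squarefree_denom hq (hΩ k j))
  have hφj : RatFunc.PoleBound q (n + 2) (φ j) := hφ j
  exact (hφj.add hderiv).add hsum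
end

section
/- Let z₀ ∈ ℂ, let A be an invertible ν×ν complex matrix, let b_L, b_R ∈ ℂ^ν, let G be a ν×ν-matrix-valued function analytic at z₀, let g_L and g_R be ℂ^ν-valued functions analytic at z₀, and let ψ be a ℂ^ν-valued (row-vector) function analytic at z₀ satisfying, for all z ≠ z₀ in some punctured neighbourhood of z₀, (∂_z ψ)(z) + ψ(z)·((z − z₀)^{−1}·A + G(z)) = (z − z₀)^{−1}·b_L + g_L(z). Define φ_R(z) = (z − z₀)^{−1}·b_R + g_R(z). Then the residue of Σ_j ψ_j·φ_{R,j} at z₀ is given by lim_{z → z₀, z ≠ z₀} (z − z₀)·Σ_{j=1}^{ν} ψ_j(z)·φ_{R,j}(z) = Σ_{j,k} (b_L)_j·(A^{−1})_{jk}·(b_R)_k; that is, res_{z=z₀}(ψ·φ_R) = b_L·A^{−1}·b_R. -/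
open Filter Topology

/-- The leading coefficient of a solution that is regular at a simple pole of the connection:
its value times the residue of the connection is the residue of the source. -/
theorem vecMul_residue_eq_of_simple_pole {ι : Type*} [Fintype ι] {z₀ : ℂ} {A : Matrix ι ι ℂ}
    {b : ι → ℂ} {G : ℂ → Matrix ι ι ℂ} {g ψ : ℂ → ι → ℂ}
    (hG : ∀ k j, ContinuousAt (fun z => G z k j) z₀)
    (hg : ∀ j, ContinuousAt (fun z => g z j) z₀)
    (hψ : ∀ j, ContinuousAt (fun z => ψ z j) z₀)
    (hψ' : ∀ j, ContinuousAt (deriv fun z => ψ z j) z₀)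
    (heq : ∀ᶠ z in 𝓝[≠] z₀, ∀ j,
      deriv (fun w => ψ w j) z + ∑ k, ψ z k * ((z - z₀)⁻¹ * A k j + G z k j)
        = (z - z₀)⁻¹ * b j + g z j) :
    Matrix.vecMul (ψ z₀) A = b := by
  funext j
  have hl : ContinuousAt (fun z => (z - z₀) * deriv (fun w => ψ w j) z
      + ∑ k, ψ z k * (A k j + (z - z₀) * G z k j)) z₀ := by
    have := hψ' j
    fun_prop
  have hr : ContinuousAt (fun z => b j + (z - z₀) * g z j) z₀ := by fun_prop
  have hlr := tendsto_nhds_unique_of_eventuallyEq (hl.tendsto.mono_left nhdsWithin_le_nhds)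
    (hr.tendsto.mono_left nhdsWithin_le_nhds) (l := 𝓝[≠] z₀) (by
      filter_upwards [heq, self_mem_nhdsWithin] with z hz hne
      have hne : z - z₀ ≠ 0 := sub_ne_zero.mpr hne
      have h := congrArg ((z - z₀) * ·) (hz j)
      simp only [mul_add, Finset.mul_sum, mul_inv_cancel_left₀ hne] at h
      rw [← h, add_right_inj]
      refine Finset.sum_congr rfl fun k _ => ?_
      field_simp)
  simpa [Matrix.vecMul, dotProduct] using hlr

/-- The pairing of a continuous vector function with a simple-pole one has as residue
the pairing of its value with the residue. -/
theorem tendsto_sub_mul_sum_simple_pole {ι : Type*} [Fintype ι] {z₀ : ℂ} {b : ι → ℂ}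
    {g ψ : ℂ → ι → ℂ} (hg : ∀ j, ContinuousAt (fun z => g z j) z₀)
    (hψ : ∀ j, ContinuousAt (fun z => ψ z j) z₀) :
    Tendsto (fun z => (z - z₀) * ∑ j, ψ z j * ((z - z₀)⁻¹ * b j + g z j))
      (𝓝[≠] z₀) (𝓝 (ψ z₀ ⬝ᵥ b)) := by
  have hc : ContinuousAt (fun z => ∑ j, ψ z j * (b j + (z - z₀) * g z j)) z₀ := by fun_prop
  have ht := hc.tendsto.mono_left (nhdsWithin_le_nhds (s := {z₀}ᶜ))
  simp only [sub_self, zero_mul, add_zero] at ht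
  refine ht.congr' ?_
  filter_upwards [self_mem_nhdsWithin] with z hne
  have hne : z - z₀ ≠ 0 := sub_ne_zero.mpr hne
  rw [Finset.mul_sum]
  refine Finset.sum_congr rfl fun k _ => ?_
  field_simp

/-- Local residue computation for the intersection number at a simple pole: if `ψ` is
analytic at `z₀` and solves `∂_z ψ + ψ·((z−z₀)⁻¹·A + G(z)) = (z−z₀)⁻¹·b_L + g_L(z)` on
a punctured neighbourhood of `z₀`, with `A` invertible and `G`, `g_L`, `g_R` analytic
at `z₀`, and `φ_R(z) = (z−z₀)⁻¹·b_R + g_R(z)`, then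
`res_{z=z₀}(ψ·φ_R) = lim_{z→z₀} (z−z₀)·∑ⱼ ψⱼ(z)·φ_{R,j}(z) = b_L·A⁻¹·b_R`. -/
theorem residue_of_solution_pairing
    (ν : ℕ) (z₀ : ℂ) (A : Matrix (Fin ν) (Fin ν) ℂ) (hA : IsUnit A.det)
    (bL bR : Fin ν → ℂ)
    (G : ℂ → Matrix (Fin ν) (Fin ν) ℂ) (gL gR : ℂ → Fin ν → ℂ) (ψ : ℂ → Fin ν → ℂ)
    (hG : ∀ k j, AnalyticAt ℂ (fun z => G z k j) z₀)
    (hgL : ∀ j, AnalyticAt ℂ (fun z => gL z j) z₀)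
    (hgR : ∀ j, AnalyticAt ℂ (fun z => gR z j) z₀)
    (hψ : ∀ j, AnalyticAt ℂ (fun z => ψ z j) z₀)
    (heq : ∀ᶠ z in 𝓝[≠] z₀, ∀ j,
      deriv (fun w => ψ w j) z
        + ∑ k, ψ z k * ((z - z₀)⁻¹ * A k j + G z k j)
      = (z - z₀)⁻¹ * bL j + gL z j) :
    Tendsto (fun z => (z - z₀) * ∑ j, ψ z j * ((z - z₀)⁻¹ * bR j + gR z j))
      (𝓝[≠] z₀) (𝓝 (∑ j, ∑ k, bL j * A⁻¹ j k * bR k)) := by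
  have hA' : Matrix.vecMul (ψ z₀) A = bL :=
    vecMul_residue_eq_of_simple_pole (fun k j => (hG k j).continuousAt)
      (fun j => (hgL j).continuousAt) (fun j => (hψ j).continuousAt)
      (fun j => (hψ j).deriv.continuousAt) heq
  have hψ₀ : ψ z₀ = Matrix.vecMul bL A⁻¹ := by
    rw [← hA', Matrix.vecMul_vecMul, Matrix.mul_nonsing_inv A hA, Matrix.vecMul_one]
  have hsum : ∑ j, ∑ k, bL j * A⁻¹ j k * bR k = ψ z₀ ⬝ᵥ bR := by
    rw [hψ₀, Finset.sum_comm]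
    simp only [Matrix.vecMul, dotProduct, Finset.sum_mul]
  rw [hsum]
  exact tendsto_sub_mul_sum_simple_pole (fun j => (hgR j).continuousAt)
    fun j => (hψ j).continuousAt
end
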